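/- Let H be a complex Hilbert space, let T ≠ 0 be a bounded self-adjoint operator on H, and fix real numbers a > 0 with a·‖T‖² < 1, c ≥ 0, b > 0, k > 0. Define g : [0,∞) → ℝ by g(y) = y^{−c} e^{−b y^{−k}} for y > 0 and g(0) = 0, a continuous function, and define F(λ) = T² (λT² − 1)^{−1} λ^c exp(−bλ^k) with principal-branch complex powers. Then the three operator-valued integrals below converge absolutely in operator norm and (1/(2πi)) · [ −∫_{−∞}^{−a} F(−t + i) dt − i·∫_{−1}^{1} F(a − ti) dt + ∫_{a}^{∞} F(t − i) dt ] = g(T²), the continuous functional calculus of g applied to the positive operator T². -/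

import Mathlib

open MeasureTheory Complex

/-- The integrand `λ ↦ T² (λT² - 1)⁻¹ λ^c exp (-b λ^k)` of the paper's Lemma C.4,
with principal-branch complex powers. -/
noncomputable def contourIntegrandC4 {H : Type*} [NormedAddCommGroup H]
    [InnerProductSpace ℂ H] [CompleteSpace H]
    (T : H →L[ℂ] H) (c b k : ℝ) (l : ℂ) : H →L[ℂ] H :=
  (l ^ (c : ℂ) * Complex.exp (-(b : ℂ) * l ^ (k : ℂ))) •
    (T ^ 2 * Ring.inverse (l • T ^ 2 - 1))

/-- The scalar weight `λ ↦ λ^c exp (-b λ^k)` multiplying the resolvent in `contourIntegrandC4`. -/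
noncomputable def expWeight (c b k : ℝ) (l : ℂ) : ℂ :=
  l ^ (c : ℂ) * Complex.exp (-(b : ℂ) * l ^ (k : ℂ))

lemma differentiableOn_expWeight (c b k : ℝ) :
    DifferentiableOn ℂ (expWeight c b k) {z | 0 < z.re} := by
  intro z hz
  have hz' : z ∈ slitPlane := Or.inl hz
  unfold expWeight
  apply DifferentiableAt.differentiableWithinAt
  have h1 : ∀ s : ℂ, DifferentiableAt ℂ (fun l : ℂ => l ^ s) z := fun s =>
    differentiableAt_id.cpow_const hz'
  exact (h1 _).mul ((h1 _).const_mul _).cexp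

open Filter Topology in
lemma exists_norm_expWeight_le {c b k : ℝ} (hc : 0 ≤ c) (hb : 0 < b) (hk : 0 < k) :
    ∃ t₀ : ℝ, 1 ≤ t₀ ∧ ∀ z : ℂ, t₀ ≤ z.re → |z.im| ≤ 1 →
      ‖expWeight c b k z‖ ≤ z.re ^ (-2 : ℝ) := by
  have h1 : Tendsto (fun t : ℝ => 2 ^ c * (t ^ (c + 2) * Real.exp (-(b / 2) * t ^ k))) atTop
      (𝓝 0) := by
    have h2 := (tendsto_rpow_mul_exp_neg_mul_atTop_nhds_zero ((c + 2) / k) (b / 2)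
      (by positivity)).comp (tendsto_rpow_atTop hk)
    have h3 := h2.const_mul (2 ^ c)
    rw [mul_zero] at h3
    refine h3.congr' ?_
    filter_upwards [eventually_ge_atTop 0] with t ht
    simp only [Function.comp]
    rw [← Real.rpow_mul ht, mul_div_cancel₀ _ hk.ne']
  have h4 : ∀ᶠ x : ℝ in 𝓝 0, |Real.arcsin x * k| < Real.pi / 3 := by
    have : ContinuousAt (fun x : ℝ => |Real.arcsin x * k|) 0 := by fun_prop
    have h0 : |Real.arcsin 0 * k| < Real.pi / 3 := by simp [Real.pi_pos]
    exact this.eventually_lt_const h0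
  obtain ⟨δ, hδ, h5⟩ := Metric.eventually_nhds_iff.1 h4
  obtain ⟨t₁, h6⟩ := eventually_atTop.1 (h1.eventually_lt_const (zero_lt_one))
  refine ⟨max (max 1 (2 / δ)) t₁, le_trans (le_max_left _ _) (le_max_left _ _), ?_⟩
  intro z hz him
  obtain ⟨⟨hz1, hz2⟩, hz3⟩ := by simpa only [max_le_iff] using hz
  have hre : 0 < z.re := by linarith
  have hn : z.re ≤ ‖z‖ := re_le_norm z
  have hn2 : ‖z‖ ≤ 2 * z.re := by
    have := Complex.norm_le_abs_re_add_abs_im z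
    rw [abs_of_pos hre] at this
    linarith
  have hcos : 1 / 2 ≤ Real.cos (arg z * k) := by
    have harg : |arg z * k| < Real.pi / 3 := by
      rw [arg_of_re_nonneg hre.le]
      apply h5
      rw [Real.dist_eq, sub_zero, abs_div, abs_norm]
      have h7 : 2 ≤ z.re * δ := (div_le_iff₀ hδ).1 hz2
      rw [div_lt_iff₀ (by linarith)]
      nlinarith
    rw [← Real.cos_pi_div_three, ← Real.cos_abs (arg z * k)]
    exact Real.cos_le_cos_of_nonneg_of_le_pi (abs_nonneg _) (by linarith [Real.pi_pos]) harg.le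
  unfold expWeight
  rw [norm_mul, norm_cpow_real, Complex.norm_exp]
  have hre2 : (-(b : ℂ) * z ^ (k : ℂ)).re = -b * (‖z‖ ^ k * Real.cos (arg z * k)) := by
    rw [← ofReal_neg, re_ofReal_mul, cpow_ofReal_re]
  rw [hre2]
  have h8 : ‖z‖ ^ c ≤ 2 ^ c * z.re ^ c := by
    rw [← Real.mul_rpow (by norm_num) hre.le]
    exact Real.rpow_le_rpow (norm_nonneg _) hn2 hc
  have h9 : -b * (‖z‖ ^ k * Real.cos (arg z * k)) ≤ -(b / 2) * z.re ^ k := by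
    have h10 : z.re ^ k ≤ ‖z‖ ^ k := Real.rpow_le_rpow hre.le hn hk.le
    have h11 : 0 < z.re ^ k := by positivity
    have h12 : z.re ^ k * (1 / 2) ≤ ‖z‖ ^ k * Real.cos (arg z * k) := by gcongr
    nlinarith
  calc ‖z‖ ^ c * Real.exp (-b * (‖z‖ ^ k * Real.cos (arg z * k)))
      ≤ 2 ^ c * z.re ^ c * Real.exp (-(b / 2) * z.re ^ k) := by gcongr
    _ = z.re ^ (-2 : ℝ) * (2 ^ c * (z.re ^ (c + 2) * Real.exp (-(b / 2) * z.re ^ k))) := by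
        have h13 : z.re ^ c = z.re ^ (-2 : ℝ) * z.re ^ (c + 2) := by
          rw [← Real.rpow_add hre]; congr 1; ring
        rw [h13]; ring
    _ ≤ z.re ^ (-2 : ℝ) * 1 := by gcongr; exact (h6 _ hz3).le
    _ = _ := mul_one _

open Filter in
lemma integrableOn_Ici_of_norm_le_rpow {f : ℝ → ℂ} {a t₀ : ℝ}
    (hf : ContinuousOn f (Set.Ici a)) (hb : ∀ t, t₀ ≤ t → ‖f t‖ ≤ t ^ (-2 : ℝ)) :
    IntegrableOn f (Set.Ici a) := by
  refine (hf.locallyIntegrableOn measurableSet_Ici).integrableOn_of_isBigO_atTop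
    (g := fun t : ℝ => t ^ (-2 : ℝ)) (Asymptotics.IsBigO.of_bound 1 ?_)
    ⟨Set.Ioi 1, Ioi_mem_atTop 1, integrableOn_Ioi_rpow_of_lt (by norm_num) one_pos⟩
  filter_upwards [eventually_ge_atTop t₀, eventually_ge_atTop 0] with t ht ht'
  rw [one_mul, Real.norm_of_nonneg (by positivity)]
  exact hb t ht

private lemma log_neg_of_im_pos {z : ℂ} (hz : 0 < z.im) :
    Complex.log (-z) = Complex.log z - Real.pi * I := by
  rw [Complex.log, Complex.log, norm_neg, arg_neg_eq_arg_sub_pi_of_im_pos hz]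
  push_cast; ring

private lemma log_neg_of_im_neg {z : ℂ} (hz : z.im < 0) :
    Complex.log (-z) = Complex.log z + Real.pi * I := by
  rw [Complex.log, Complex.log, norm_neg, arg_neg_eq_arg_add_pi_of_im_neg hz]
  push_cast; ring

/-- Along an affine path `t ↦ z + t v`, if `m (z + t v)` avoids the branch cut of the logarithm,
then `v (z + t v)⁻¹` integrates to the increment of `log (m (z + t v))`. -/
lemma integral_inv_affine {z v m : ℂ} {s t : ℝ}
    (h : ∀ x ∈ Set.uIcc s t, m * (z + x * v) ∈ slitPlane) :
    v * ∫ x in s..t, (z + x * v)⁻¹ =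
      Complex.log (m * (z + t * v)) - Complex.log (m * (z + s * v)) := by
  have hne : ∀ x ∈ Set.uIcc s t, m * (z + x * v) ≠ 0 := fun x hx => slitPlane_ne_zero (h x hx)
  rw [← intervalIntegral.integral_const_mul]
  refine intervalIntegral.integral_eq_sub_of_hasDerivAt
    (f := fun x : ℝ => Complex.log (m * (z + x * v))) (fun x hx => ?_) ?_
  · have h1 : HasDerivAt (fun x : ℝ => m * (z + x * v)) (m * v) x := by
      have := (((hasDerivAt_id x).ofReal_comp.mul_const v).const_add z).const_mul m
      simpa using this
    have h2 := h1.clog_real (h x hx)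
    rwa [mul_div_mul_left _ _ (left_ne_zero_of_mul (hne x hx)), div_eq_mul_inv] at h2
  · apply ContinuousOn.intervalIntegrable
    refine continuousOn_const.mul (ContinuousOn.inv₀ (by fun_prop) fun x hx => ?_)
    exact right_ne_zero_of_mul (hne x hx)

/-- The integral of `1 / (z - p)` over the boundary of the rectangle `[a, R] × [-1, 1]`
containing the point `p` of the real axis in its interior. -/
lemma integral_boundary_rect_inv_sub {a p R : ℝ} (hap : a < p) (hpR : p < R) :
    (∫ x in a..R, ((x : ℂ) - I - p)⁻¹) - (∫ x in a..R, ((x : ℂ) + I - p)⁻¹)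
      + I * (∫ y in (-1 : ℝ)..1, ((R : ℂ) + y * I - p)⁻¹)
      - I * (∫ y in (-1 : ℝ)..1, ((a : ℂ) + y * I - p)⁻¹) = 2 * Real.pi * I := by
  have e1 := integral_inv_affine (z := -I - p) (v := 1) (m := 1) (s := a) (t := R)
    (fun x _ => Or.inr (by simp))
  have e2 := integral_inv_affine (z := I - p) (v := 1) (m := 1) (s := a) (t := R)
    (fun x _ => Or.inr (by simp))
  have e3 := integral_inv_affine (z := R - p) (v := I) (m := 1) (s := -1) (t := 1)
    (fun x _ => Or.inl (by simpa using hpR))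
  have e4 := integral_inv_affine (z := a - p) (v := I) (m := -1) (s := -1) (t := 1)
    (fun x _ => Or.inl (by simpa using hap))
  have f1 : ∀ x : ℝ, (x : ℂ) - I - p = -I - p + x * 1 := fun x => by ring
  have f2 : ∀ x : ℝ, (x : ℂ) + I - p = I - p + x * 1 := fun x => by ring
  have f3 : ∀ x : ℝ, (R : ℂ) + x * I - p = R - p + x * I := fun x => by ring
  have f4 : ∀ x : ℝ, (a : ℂ) + x * I - p = a - p + x * I := fun x => by ring
  simp_rw [f1, f2, f3, f4]
  rw [one_mul] at e1 e2
  rw [e1, e2, e3, e4]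
  have g1 : Complex.log (-1 * (a - p + (1 : ℝ) * I))
      = Complex.log (1 * (I - p + a * 1)) - Real.pi * I := by
    rw [← log_neg_of_im_pos (by simp)]; congr 1; push_cast; ring
  have g2 : Complex.log (-1 * (a - p + (-1 : ℝ) * I))
      = Complex.log (1 * (-I - p + a * 1)) + Real.pi * I := by
    rw [← log_neg_of_im_neg (by simp)]; congr 1; push_cast; ring
  rw [g1, g2]
  have g3 : (1 : ℂ) * (R - p + (1 : ℝ) * I) = 1 * (I - p + R * 1) := by push_cast; ring
  have g4 : (1 : ℂ) * (R - p + (-1 : ℝ) * I) = 1 * (-I - p + R * 1) := by push_cast; ring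
  rw [g3, g4]
  ring

/-- **Cauchy integral formula** for the rectangle `[a, R] × [-1, 1]` and a point of the real
axis. -/
lemma integral_boundary_rect_div_sub {φ : ℂ → ℂ} (hφ : DifferentiableOn ℂ φ {z | 0 < z.re})
    {a p R : ℝ} (ha : 0 < a) (hap : a < p) (hpR : p < R) :
    (∫ x in a..R, φ (x - I) * ((x : ℂ) - I - p)⁻¹)
      - (∫ x in a..R, φ (x + I) * ((x : ℂ) + I - p)⁻¹)
      + I * (∫ y in (-1 : ℝ)..1, φ (R + y * I) * ((R : ℂ) + y * I - p)⁻¹)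
      - I * (∫ y in (-1 : ℝ)..1, φ (a + y * I) * ((a : ℂ) + y * I - p)⁻¹)
      = 2 * Real.pi * I * φ p := by
  have hopen : IsOpen {z : ℂ | 0 < z.re} := isOpen_lt continuous_const continuous_re
  have hp : {z : ℂ | 0 < z.re} ∈ nhds (p : ℂ) := hopen.mem_nhds (by simpa using ha.trans hap)
  have hd : DifferentiableOn ℂ (dslope φ p) {z | 0 < z.re} :=
    (differentiableOn_dslope hp).2 hφ
  have key := integral_boundary_rect_eq_zero_of_differentiableOn (dslope φ p)
    (a - I) (R + I) (hd.mono (by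
      rintro z ⟨hz, -⟩
      simp only [sub_re, ofReal_re, I_re, sub_zero, add_re, add_zero, Set.mem_preimage] at hz
      rw [Set.uIcc_of_le (hap.trans hpR).le] at hz
      exact ha.trans_le hz.1))
  simp only [sub_re, add_re, ofReal_re, I_re, sub_im, add_im, ofReal_im, I_im, sub_zero, add_zero,
    zero_sub, zero_add, smul_eq_mul, ofReal_neg, ofReal_one, neg_mul, one_mul,
    ← sub_eq_add_neg] at key
  have hR : 0 < R := by linarith
  have side : ∀ (s t : ℝ) (γ : ℝ → ℂ), Continuous γ →
      (∀ x ∈ Set.uIcc s t, 0 < (γ x).re ∧ γ x ≠ p) →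
      ∫ x in s..t, dslope φ p (γ x) =
        (∫ x in s..t, φ (γ x) * (γ x - p)⁻¹) - φ p * ∫ x in s..t, (γ x - p)⁻¹ := by
    intro s t γ hγ h
    have hinv : ContinuousOn (fun x => (γ x - p)⁻¹) (Set.uIcc s t) :=
      ContinuousOn.inv₀ (by fun_prop) fun x hx => sub_ne_zero.2 (h x hx).2
    have hφγ : ContinuousOn (fun x => φ (γ x)) (Set.uIcc s t) :=
      hφ.continuousOn.comp hγ.continuousOn fun x hx => (h x hx).1
    rw [← intervalIntegral.integral_const_mul, ← intervalIntegral.integral_sub]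
    · refine intervalIntegral.integral_congr fun x hx => ?_
      rw [dslope_of_ne _ (h x hx).2, slope_def_field]
      ring
    · exact (hφγ.mul hinv).intervalIntegrable
    · exact (continuousOn_const.mul hinv).intervalIntegrable
  have hle : ∀ x ∈ Set.uIcc a R, 0 < x := fun x hx => by
    rw [Set.uIcc_of_le (hap.trans hpR).le] at hx; exact ha.trans_le hx.1
  rw [side a R (fun x => x - I) (by fun_prop) fun x hx => ⟨by simpa using hle x hx, fun h => by
      simpa using congrArg Complex.im h⟩,
    side a R (fun x => x + I) (by fun_prop) fun x hx => ⟨by simpa using hle x hx, fun h => by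
      simpa using congrArg Complex.im h⟩,
    side (-1) 1 (fun y => R + y * I) (by fun_prop) fun x hx => ⟨by simpa using hR, fun h => by
      have := congrArg Complex.re h
      simp at this; linarith⟩,
    side (-1) 1 (fun y => a + y * I) (by fun_prop) fun x hx => ⟨by simpa using ha, fun h => by
      have := congrArg Complex.re h
      simp at this; linarith⟩] at key
  linear_combination key + φ p * integral_boundary_rect_inv_sub hap hpR

open Filter Topology in
/-- **Cauchy integral formula** for the half-strip `[a, ∞) × [-1, 1]` and a point of the real
axis. -/
lemma integral_boundary_halfStrip_div_sub {φ : ℂ → ℂ}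
    (hφ : DifferentiableOn ℂ φ {z | 0 < z.re}) {t₀ : ℝ}
    (hb : ∀ z : ℂ, t₀ ≤ z.re → |z.im| ≤ 1 → ‖φ z‖ ≤ z.re ^ (-2 : ℝ))
    {a p : ℝ} (ha : 0 < a) (hap : a < p) :
    (∫ x in Set.Ici a, φ (x - I) * ((x : ℂ) - I - p)⁻¹)
      - (∫ x in Set.Ici a, φ (x + I) * ((x : ℂ) + I - p)⁻¹)
      - I * (∫ y in (-1 : ℝ)..1, φ (a + y * I) * ((a : ℂ) + y * I - p)⁻¹)
      = 2 * Real.pi * I * φ p := by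
  have horiz : ∀ w : ℂ, w.re = 0 → |w.im| = 1 →
      IntegrableOn (fun x : ℝ => φ (x + w) * ((x : ℂ) + w - p)⁻¹) (Set.Ici a) := by
    intro w hw hw'
    have him : ∀ x : ℝ, ((x : ℂ) + w - p).im = w.im := fun x => by simp
    apply integrableOn_Ici_of_norm_le_rpow (t₀ := t₀)
    · refine ContinuousOn.mul ?_ (ContinuousOn.inv₀ (by fun_prop) fun x _ h0 => ?_)
      · refine hφ.continuousOn.comp (by fun_prop) fun x hx => ?_
        simpa [hw] using ha.trans_le hx
      · have := him x
        rw [h0, zero_im] at this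
        simp [← this] at hw'
    · intro t ht
      rw [norm_mul, norm_inv]
      have h1 : 1 ≤ ‖(t : ℂ) + w - p‖ := by
        rw [← hw', ← him t]; exact abs_im_le_norm _
      have h2 := hb (t + w) (by simpa [hw] using ht) (by simp [hw'])
      calc _ ≤ ‖φ (t + w)‖ * 1 := by gcongr; exact inv_le_one_of_one_le₀ h1
        _ ≤ _ := by simpa [hw] using h2
  have lim : ∀ w : ℂ, w.re = 0 → |w.im| = 1 →
      Tendsto (fun R : ℝ => ∫ x in a..R, φ (x + w) * ((x : ℂ) + w - p)⁻¹) atTop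
        (𝓝 (∫ x in Set.Ici a, φ (x + w) * ((x : ℂ) + w - p)⁻¹)) := by
    intro w hw hw'
    rw [integral_Ici_eq_integral_Ioi]
    exact intervalIntegral_tendsto_integral_Ioi a
      ((horiz w hw hw').mono_set Set.Ioi_subset_Ici_self) tendsto_id
  have limR : Tendsto (fun R : ℝ => ∫ y in (-1 : ℝ)..1, φ (R + y * I) * ((R : ℂ) + y * I - p)⁻¹)
      atTop (𝓝 0) := by
    have h0 : Tendsto (fun R : ℝ => R ^ (-2 : ℝ) * 1 * |(1 : ℝ) - (-1)|) atTop (𝓝 0) := by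
      simpa using ((tendsto_rpow_neg_atTop (y := 2) two_pos).mul_const 1).mul_const |(1 : ℝ) - (-1)|
    refine squeeze_zero_norm' ?_ h0
    filter_upwards [eventually_ge_atTop t₀, eventually_ge_atTop (p + 1),
      eventually_ge_atTop 0] with R hR hR' hR0
    refine intervalIntegral.norm_integral_le_of_norm_le_const fun y hy => ?_
    rw [Set.uIoc_of_le (by norm_num)] at hy
    rw [norm_mul, norm_inv]
    have h1 : 1 ≤ ‖(R : ℂ) + y * I - p‖ := by
      refine le_trans ?_ (re_le_norm _)
      simp; linarith
    have h2 := hb (R + y * I) (by simpa using hR) (by simpa [abs_le] using ⟨hy.1.le, hy.2⟩)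
    have h3 : ‖φ (R + y * I)‖ ≤ R ^ (-2 : ℝ) := by simpa using h2
    gcongr
    exact inv_le_one_of_one_le₀ h1
  have l1 := lim (-I) (by simp) (by simp)
  have l2 := lim I (by simp) (by simp)
  simp only [← sub_eq_add_neg] at l1
  have l := ((l1.sub l2).add (limR.const_mul I)).sub_const
    (I * (∫ y in (-1 : ℝ)..1, φ (a + y * I) * ((a : ℂ) + y * I - p)⁻¹))
  rw [mul_zero, add_zero] at l
  refine tendsto_nhds_unique l (tendsto_const_nhds.congr' ?_)
  filter_upwards [eventually_gt_atTop p] with R hR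
  exact (integral_boundary_rect_div_sub hφ ha hap hR).symm

section Operator

variable {H : Type*} [NormedAddCommGroup H] [InnerProductSpace ℂ H] [CompleteSpace H]

lemma IsSelfAdjoint.exists_eq_ofReal_of_mem_spectrum_sq {T : H →L[ℂ] H} (hT : IsSelfAdjoint T)
    {z : ℂ} (hz : z ∈ spectrum ℂ (T ^ 2)) : ∃ y : ℝ, 0 ≤ y ∧ y ≤ ‖T‖ ^ 2 ∧ z = y := by
  have hz' : z = z.re := (hT.pow 2).mem_spectrum_eq_re hz
  refine ⟨z.re, ?_, ?_, hz'⟩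
  · have h := hz
    rw [hz', ← coe_algebraMap, spectrum.algebraMap_mem_iff] at h
    exact spectrum_nonneg_of_nonneg hT.sq_nonneg h
  · have h1 := spectrum.norm_le_norm_mul_of_mem hz
    have h2 : ‖(1 : H →L[ℂ] H)‖ ≤ 1 := ContinuousLinearMap.norm_id_le
    calc z.re ≤ ‖z‖ := re_le_norm z
      _ ≤ ‖T ^ 2‖ * 1 := h1.trans (by gcongr)
      _ ≤ ‖T‖ ^ 2 := by rw [mul_one]; exact norm_pow_le' T two_pos

lemma contourIntegrandC4_eq_cfc {T : H →L[ℂ] H} (hT : IsSelfAdjoint T) (c b k : ℝ) {l : ℂ}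
    (hl : ∀ z ∈ spectrum ℂ (T ^ 2), l * z - 1 ≠ 0) :
    contourIntegrandC4 T c b k l =
      cfc (fun z : ℂ => expWeight c b k l * (z * (l * z - 1)⁻¹)) (T ^ 2) := by
  have hS : IsStarNormal (T ^ 2) := (hT.pow 2).isStarNormal
  have hinv : ContinuousOn (fun z : ℂ => (l * z - 1)⁻¹) (spectrum ℂ (T ^ 2)) :=
    ContinuousOn.inv₀ (by fun_prop) hl
  have hmul : ContinuousOn (fun z : ℂ => z * (l * z - 1)⁻¹) (spectrum ℂ (T ^ 2)) :=
    continuousOn_id.mul hinv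
  rw [cfc_const_mul _ _ _ hmul, cfc_mul (fun z : ℂ => z) _ _ (by fun_prop) hinv,
    cfc_inv _ _ hl, cfc_sub _ _ _, cfc_const_mul _ _ _, cfc_id' ℂ (T ^ 2),
    cfc_const_one ℂ (T ^ 2)]
  rfl

/-- Integrals of `contourIntegrandC4` along a path can be computed pointwise on the spectrum. -/
lemma integral_contourIntegrandC4 {T : H →L[ℂ] H} (hT : IsSelfAdjoint T) {c b k K : ℝ}
    {s : Set ℝ} (hs : MeasurableSet s) {γ : ℝ → ℂ} (hγ : Continuous γ)
    (hre : ∀ t ∈ s, 0 < (γ t).re)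
    (hK : ∀ t ∈ s, ∀ y : ℝ, 0 ≤ y → y ≤ ‖T‖ ^ 2 →
      γ t * y - 1 ≠ 0 ∧ ‖(y : ℂ) * (γ t * y - 1)⁻¹‖ ≤ K)
    (hint : IntegrableOn (fun t => expWeight c b k (γ t)) s) :
    ContinuousOn (fun z : ℂ => ∫ t in s, expWeight c b k (γ t) * (z * (γ t * z - 1)⁻¹))
        (spectrum ℂ (T ^ 2)) ∧
      IntegrableOn (fun t => contourIntegrandC4 T c b k (γ t)) s ∧
      ∫ t in s, contourIntegrandC4 T c b k (γ t) =
        cfc (fun z : ℂ => ∫ t in s, expWeight c b k (γ t) * (z * (γ t * z - 1)⁻¹)) (T ^ 2) := by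
  have hS : IsStarNormal (T ^ 2) := (hT.pow 2).isStarNormal
  have hK' : ∀ t ∈ s, ∀ z ∈ spectrum ℂ (T ^ 2),
      γ t * z - 1 ≠ 0 ∧ ‖z * (γ t * z - 1)⁻¹‖ ≤ K := by
    intro t ht z hz
    obtain ⟨y, hy0, hy1, rfl⟩ := hT.exists_eq_ofReal_of_mem_spectrum_sq hz
    exact hK t ht y hy0 hy1
  have hw : ContinuousOn (fun t => expWeight c b k (γ t)) s :=
    (differentiableOn_expWeight c b k).continuousOn.comp hγ.continuousOn hre
  have hcont : ContinuousOn (Function.uncurry fun (t : ℝ) (z : ℂ) =>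
      expWeight c b k (γ t) * (z * (γ t * z - 1)⁻¹)) (s ×ˢ spectrum ℂ (T ^ 2)) := by
    refine ContinuousOn.mul (hw.comp continuousOn_fst fun x hx => hx.1) ?_
    refine continuousOn_snd.mul (ContinuousOn.inv₀ (by fun_prop) fun x hx => ?_)
    exact (hK' x.1 hx.1 x.2 hx.2).1
  have hbd : ∀ t ∈ s, ∀ z ∈ spectrum ℂ (T ^ 2),
      ‖expWeight c b k (γ t) * (z * (γ t * z - 1)⁻¹)‖ ≤ ‖expWeight c b k (γ t)‖ * K := by
    intro t ht z hz
    rw [norm_mul]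
    gcongr
    exact (hK' t ht z hz).2
  have hbint : IntegrableOn (fun t => ‖expWeight c b k (γ t)‖ * K) s := hint.norm.mul_const K
  have hae : ∀ᵐ t ∂volume.restrict s, ∀ z ∈ spectrum ℂ (T ^ 2),
      ‖expWeight c b k (γ t) * (z * (γ t * z - 1)⁻¹)‖ ≤ ‖expWeight c b k (γ t)‖ * K :=
    ae_restrict_of_forall_mem hs hbd
  have heq : Set.EqOn (fun t => cfc (fun z : ℂ => expWeight c b k (γ t) * (z * (γ t * z - 1)⁻¹))
      (T ^ 2)) (fun t => contourIntegrandC4 T c b k (γ t)) s := fun t ht =>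
    (contourIntegrandC4_eq_cfc hT c b k fun z hz => (hK' t ht z hz).1).symm
  refine ⟨?_, ?_, ?_⟩
  · refine continuousOn_of_dominated (fun z hz => ?_)
      (fun z hz => hae.mono fun t ht => ht z hz) hbint ?_
    · exact (hcont.comp (f := fun t : ℝ => (t, z)) (by fun_prop)
        fun t ht => ⟨ht, hz⟩).aestronglyMeasurable hs
    · exact ae_restrict_of_forall_mem hs fun t ht =>
        hcont.comp (f := fun z : ℂ => (t, z)) (by fun_prop) fun z hz => ⟨ht, hz⟩
  · exact (integrableOn_cfc hs _ _ (T ^ 2) hcont hae hbint.2).congr_fun heq hs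
  · rw [cfc_setIntegral hs _ _ (T ^ 2) hcont hae hbint.2]
    exact (setIntegral_congr_fun hs heq).symm

end Operator

lemma norm_mul_inv_le_one_of_abs_im_eq_one {l : ℂ} (hl : |l.im| = 1) {y : ℝ} (hy : 0 ≤ y) :
    l * y - 1 ≠ 0 ∧ ‖(y : ℂ) * (l * y - 1)⁻¹‖ ≤ 1 := by
  have him : (l * y - 1).im = l.im * y := by simp
  have hle : y ≤ ‖l * y - 1‖ := by
    have := abs_im_le_norm (l * y - 1)
    rwa [him, abs_mul, hl, one_mul, abs_of_nonneg hy] at this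
  refine ⟨fun h0 => ?_, ?_⟩
  · rw [h0, norm_zero] at hle
    obtain rfl : y = 0 := le_antisymm hle hy
    simp at h0
  · rw [norm_mul, norm_inv, norm_real, Real.norm_of_nonneg hy]
    exact mul_inv_le_one_of_le₀ hle (norm_nonneg _)

lemma norm_mul_inv_le_of_re_mul_lt_one {l : ℂ} {M : ℝ} (hre : 0 ≤ l.re) (hM : l.re * M < 1)
    {y : ℝ} (hy : 0 ≤ y) (hyM : y ≤ M) :
    l * y - 1 ≠ 0 ∧ ‖(y : ℂ) * (l * y - 1)⁻¹‖ ≤ M * (1 - l.re * M)⁻¹ := by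
  have hpos : 0 < 1 - l.re * M := by linarith
  have hle : 1 - l.re * M ≤ ‖l * y - 1‖ := by
    have h1 := abs_re_le_norm (l * y - 1)
    have h2 : (l * y - 1).re = l.re * y - 1 := by simp
    have h3 : l.re * y ≤ l.re * M := by gcongr
    rw [h2] at h1
    linarith [neg_abs_le (l.re * y - 1)]
  refine ⟨norm_pos_iff.1 (hpos.trans_le hle), ?_⟩
  rw [norm_mul, norm_inv, norm_real, Real.norm_of_nonneg hy]
  have : 0 ≤ M := hy.trans hyM
  gcongr

/-- Cauchy's formula for the half-strip, in the parametrization of the contour used for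
`contourIntegrandC4`. -/
lemma contour_integral_expWeight {a c b k : ℝ} (ha : 0 < a) (hc : 0 ≤ c) (hb : 0 < b) (hk : 0 < k)
    {y : ℝ} (hy : 0 < y) (hay : a * y < 1) :
    (2 * (Real.pi : ℂ) * I)⁻¹ *
      (-(∫ t in Set.Iic (-a), expWeight c b k (-t + I) * (y * (((-t : ℂ) + I) * y - 1)⁻¹)) -
        I * (∫ t in Set.Ioc (-1 : ℝ) 1,
          expWeight c b k (a - t * I) * (y * (((a : ℂ) - t * I) * y - 1)⁻¹)) +
        ∫ t in Set.Ici a, expWeight c b k (t - I) * (y * (((t : ℂ) - I) * y - 1)⁻¹)) =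
      (y ^ (-c) * Real.exp (-b * y ^ (-k)) : ℝ) := by
  obtain ⟨t₀, -, ht₀⟩ := exists_norm_expWeight_le hc hb hk
  have hap : a < y⁻¹ := by rwa [lt_inv_comm₀ ha hy, ← one_div, lt_div_iff₀' ha]
  have key := integral_boundary_halfStrip_div_sub (differentiableOn_expWeight c b k) ht₀ ha hap
  have hy' : (y : ℂ) ≠ 0 := by exact_mod_cast hy.ne'
  have hres : ∀ l : ℂ, (y : ℂ) * (l * y - 1)⁻¹ = (l - (y⁻¹ : ℝ))⁻¹ := by
    intro l
    rw [← inv_inv (y : ℂ), ← mul_inv, inv_inv]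
    congr 1
    push_cast
    field_simp
  simp_rw [hres]
  have h1 : ∫ t in Set.Iic (-a), expWeight c b k (-t + I) * (((-t : ℂ) + I) - (y⁻¹ : ℝ))⁻¹
      = ∫ t in Set.Ici a, expWeight c b k (t + I) * (((t : ℂ) + I) - (y⁻¹ : ℝ))⁻¹ := by
    have := integral_comp_neg_Iic (-a)
      (fun t : ℝ => expWeight c b k (t + I) * (((t : ℂ) + I) - (y⁻¹ : ℝ))⁻¹)
    rw [neg_neg, ← integral_Ici_eq_integral_Ioi] at this
    rw [← this]
    simp only [ofReal_neg]
  have h2 : ∫ t in Set.Ioc (-1 : ℝ) 1,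
        expWeight c b k (a - t * I) * (((a : ℂ) - t * I) - (y⁻¹ : ℝ))⁻¹
      = ∫ t in (-1 : ℝ)..1, expWeight c b k (a + t * I) * (((a : ℂ) + t * I) - (y⁻¹ : ℝ))⁻¹ := by
    rw [← intervalIntegral.integral_of_le (by norm_num)]
    have := intervalIntegral.integral_comp_neg (a := -1) (b := 1)
      (fun t : ℝ => expWeight c b k (a + t * I) * (((a : ℂ) + t * I) - (y⁻¹ : ℝ))⁻¹)
    rw [neg_neg] at this
    rw [← this]
    simp only [ofReal_neg, neg_mul, ← sub_eq_add_neg]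
  have hval : expWeight c b k (y⁻¹ : ℝ) = (y ^ (-c) * Real.exp (-b * y ^ (-k)) : ℝ) := by
    have hinv : 0 ≤ y⁻¹ := by positivity
    unfold expWeight
    rw [← ofReal_cpow hinv, ← ofReal_cpow hinv, Real.inv_rpow hy.le, Real.inv_rpow hy.le,
      ← Real.rpow_neg hy.le, ← Real.rpow_neg hy.le]
    push_cast
    rfl
  rw [h1, h2, ← hval, inv_mul_eq_iff_eq_mul₀ (by simp [Real.pi_ne_zero]), ← key]
  ring

/-- Lemma C.4: for a nonzero bounded self-adjoint `T` on a complex Hilbert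
space, `a > 0` with `a‖T‖² < 1`, `c ≥ 0`, `b > 0`, `k > 0`, and with
`g(y) = y^(-c) e^(-b y^(-k))` for `y > 0` and `g(y) = 0` for `y ≤ 0`, the operator-valued
contour integrals converge absolutely in operator norm, and
`(1/(2πi)) ∫_σ T² (λT²-1)⁻¹ λ^c exp(-bλ^k) dλ = g(T²)` (continuous functional calculus). -/
theorem statement19 {H : Type*} [NormedAddCommGroup H] [InnerProductSpace ℂ H]
    [CompleteSpace H] (T : H →L[ℂ] H) (hT : IsSelfAdjoint T) (hT0 : T ≠ 0)
    (a c b k : ℝ) (ha : 0 < a) (haT : a * ‖T‖ ^ 2 < 1) (hc : 0 ≤ c) (hb : 0 < b)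
    (hk : 0 < k)
    (g : ℝ → ℝ)
    (hg_pos : ∀ y : ℝ, 0 < y → g y = y ^ (-c) * Real.exp (-b * y ^ (-k)))
    (hg_zero : ∀ y : ℝ, y ≤ 0 → g y = 0) :
    IntegrableOn (fun t : ℝ => contourIntegrandC4 T c b k ((-t : ℂ) + Complex.I))
      (Set.Iic (-a)) ∧
    IntervalIntegrable (fun t : ℝ => contourIntegrandC4 T c b k ((a : ℂ) - (t : ℂ) * Complex.I))
      volume (-1) 1 ∧
    IntegrableOn (fun t : ℝ => contourIntegrandC4 T c b k ((t : ℂ) - Complex.I))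
      (Set.Ici a) ∧
    ((2 * (Real.pi : ℂ) * Complex.I)⁻¹) •
      (-(∫ t in Set.Iic (-a), contourIntegrandC4 T c b k ((-t : ℂ) + Complex.I)) -
        Complex.I • (∫ t in (-1:ℝ)..1, contourIntegrandC4 T c b k ((a : ℂ) - (t : ℂ) * Complex.I)) +
        (∫ t in Set.Ici a, contourIntegrandC4 T c b k ((t : ℂ) - Complex.I))) =
      cfc g (T ^ 2) := by
  obtain ⟨t₀, -, ht₀⟩ := exists_norm_expWeight_le hc hb hk
  have hS : IsStarNormal (T ^ 2) := (hT.pow 2).isStarNormal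
  have hray : ∀ w : ℂ, w.re = 0 → |w.im| = 1 →
      IntegrableOn (fun t : ℝ => expWeight c b k (t + w)) (Set.Ici a) := by
    intro w hw hw'
    refine integrableOn_Ici_of_norm_le_rpow (t₀ := t₀) ?_ fun t ht => ?_
    · refine (differentiableOn_expWeight c b k).continuousOn.comp (by fun_prop) fun t ht => ?_
      simpa [hw] using ha.trans_le ht
    · simpa [hw] using ht₀ (t + w) (by simpa [hw] using ht) (by simp [hw'])
  have hint1 : IntegrableOn (fun t : ℝ => expWeight c b k ((-t : ℂ) + I)) (Set.Iic (-a)) := by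
    have := ((Measure.measurePreserving_neg (volume : Measure ℝ)).integrableOn_comp_preimage
      (MeasurableEquiv.neg ℝ).measurableEmbedding).2 (hray I (by simp) (by simp))
    simpa [Function.comp_def] using this
  have hint3 : IntegrableOn (fun t : ℝ => expWeight c b k ((t : ℂ) - I)) (Set.Ici a) := by
    simpa only [← sub_eq_add_neg] using hray (-I) (by simp) (by simp)
  have hint2 : IntegrableOn (fun t : ℝ => expWeight c b k ((a : ℂ) - t * I))
      (Set.Ioc (-1 : ℝ) 1) := by
    refine Continuous.integrableOn_Ioc (continuousOn_univ.1 ?_)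
    refine (differentiableOn_expWeight c b k).continuousOn.comp (by fun_prop) fun t _ => ?_
    simpa using ha
  obtain ⟨c1, i1, e1⟩ := integral_contourIntegrandC4 hT measurableSet_Iic
    (γ := fun t : ℝ => (-t : ℂ) + I) (by fun_prop)
    (fun t ht => by simpa using (by linarith [Set.mem_Iic.1 ht] : t < 0))
    (fun t _ y hy _ => norm_mul_inv_le_one_of_abs_im_eq_one (by simp) hy) hint1
  obtain ⟨c2, i2, e2⟩ := integral_contourIntegrandC4 hT measurableSet_Ioc
    (γ := fun t : ℝ => (a : ℂ) - t * I) (by fun_prop) (fun t _ => by simpa using ha)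
    (K := ‖T‖ ^ 2 * (1 - a * ‖T‖ ^ 2)⁻¹)
    (fun t _ y hy hy' => by
      have hre : ((a : ℂ) - t * I).re = a := by simp
      have := norm_mul_inv_le_of_re_mul_lt_one (l := (a : ℂ) - t * I) (M := ‖T‖ ^ 2)
        (by rw [hre]; exact ha.le) (by rwa [hre]) hy hy'
      rwa [hre] at this) hint2
  obtain ⟨c3, i3, e3⟩ := integral_contourIntegrandC4 hT measurableSet_Ici
    (γ := fun t : ℝ => (t : ℂ) - I) (by fun_prop)
    (fun t ht => by simpa using ha.trans_le ht)
    (fun t _ y hy _ => norm_mul_inv_le_one_of_abs_im_eq_one (by simp) hy) hint3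
  refine ⟨i1, (intervalIntegrable_iff_integrableOn_Ioc_of_le (by norm_num)).2 i2, i3, ?_⟩
  have c1' := c1.fun_neg
  have c2' := (continuousOn_const (c := I)).fun_mul c2
  have c12 := c1'.fun_sub c2'
  rw [intervalIntegral.integral_of_le (by norm_num), e1, e2, e3,
    ← cfc_neg _ _, ← cfc_const_mul _ _ _ c2, ← cfc_sub _ _ _ c1' c2', ← cfc_add _ _ _ c12 c3,
    ← cfc_const_mul _ _ _ (c12.fun_add c3),
    cfc_real_eq_complex g (hT.pow 2)]
  refine cfc_congr fun z hz => ?_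
  obtain ⟨y, hy0, hy1, rfl⟩ := hT.exists_eq_ofReal_of_mem_spectrum_sq hz
  rcases hy0.eq_or_lt with rfl | hy
  · simp [hg_zero 0 le_rfl]
  · simp only [ofReal_re]
    rw [hg_pos y hy]
    exact contour_integral_expWeight ha hc hb hk hy
      ((mul_le_mul_of_nonneg_left hy1 ha.le).trans_lt haT)
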